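/- arXiv:1410.8100 — 6 statements merged into one kernel-verified Lean document; each statement's English description precedes it below -/
import Mathlib

section
/- Let 0 < x ≤ y < 1 and 0 ≤ ρ₁ ≤ ρ₂ ≤ 1/2, and write (x₁,y₁) = T_{ρ₁}(x,y) and (x₂,y₂) = T_{ρ₂}(x,y). Then the chain of inequalities x/y ≤ x₁/y₁ ≤ x₂/y₂ ≤ 1 ≤ (1−x₂)/(1−y₂) ≤ (1−x₁)/(1−y₁) ≤ (1−x)/(1−y) holds. -/
/-- The BSC transform of an operating point `(x,y)` with crossover probability `ρ`. -/
noncomputable def bscT (ρ : ℝ) (p : ℝ × ℝ) : ℝ × ℝ :=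
  (ρ + (1 - 2 * ρ) * p.1, ρ + (1 - 2 * ρ) * p.2)

theorem bscT_zero (p : ℝ × ℝ) : bscT 0 p = p := by
  simp [bscT]

/-- The binary symmetric channel maps `(0, 1)` into `(0, 1)`. -/
theorem bsc_mem_Ioo {ρ t : ℝ} (hρ : ρ ∈ Set.Icc (0 : ℝ) 1) (ht : t ∈ Set.Ioo (0 : ℝ) 1) :
    ρ + (1 - 2 * ρ) * t ∈ Set.Ioo (0 : ℝ) 1 := by
  obtain ⟨hρ0, hρ1⟩ := hρ
  obtain ⟨ht0, ht1⟩ := ht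
  constructor
  · rcases hρ0.eq_or_lt with rfl | hρ0
    · simpa using ht0
    · nlinarith [mul_pos hρ0 (sub_pos.2 ht1), mul_nonneg (sub_nonneg.2 hρ1) ht0.le]
  · rcases hρ0.eq_or_lt with rfl | hρ0
    · simpa using ht1
    · nlinarith [mul_pos hρ0 ht0, mul_nonneg (sub_nonneg.2 hρ1) (sub_pos.2 ht1).le]

section Monotonicity

variable {x y a b : ℝ}

/-- The first likelihood ratio of an operating point increases with the crossover probability. -/
theorem bscT_fst_div_snd_le (hxy : x ≤ y) (hy : y ∈ Set.Ioo (0 : ℝ) 1)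
    (ha : 0 ≤ a) (hab : a ≤ b) (hb : b ≤ 1) :
    (bscT a (x, y)).1 / (bscT a (x, y)).2 ≤ (bscT b (x, y)).1 / (bscT b (x, y)).2 := by
  have hya := (bsc_mem_Ioo ⟨ha, hab.trans hb⟩ hy).1
  have hyb := (bsc_mem_Ioo ⟨ha.trans hab, hb⟩ hy).1
  simp only [bscT]
  rw [div_le_div_iff₀ hya hyb]
  linarith [mul_nonneg (sub_nonneg.2 hxy) (sub_nonneg.2 hab)]

/-- The second likelihood ratio of an operating point decreases with the crossover probability. -/
theorem bscT_one_sub_fst_div_one_sub_snd_le (hxy : x ≤ y) (hy : y ∈ Set.Ioo (0 : ℝ) 1)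
    (ha : 0 ≤ a) (hab : a ≤ b) (hb : b ≤ 1) :
    (1 - (bscT b (x, y)).1) / (1 - (bscT b (x, y)).2) ≤
      (1 - (bscT a (x, y)).1) / (1 - (bscT a (x, y)).2) := by
  have hya := (bsc_mem_Ioo ⟨ha, hab.trans hb⟩ hy).2
  have hyb := (bsc_mem_Ioo ⟨ha.trans hab, hb⟩ hy).2
  simp only [bscT]
  rw [div_le_div_iff₀ (sub_pos.2 hyb) (sub_pos.2 hya)]
  linarith [mul_nonneg (sub_nonneg.2 hxy) (sub_nonneg.2 hab)]

end Monotonicity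

/-- For `0 < x ≤ y < 1` and `0 ≤ ρ₁ ≤ ρ₂ ≤ 1/2`, with `(x₁,y₁) = T_{ρ₁}(x,y)` and
`(x₂,y₂) = T_{ρ₂}(x,y)`, the chain of likelihood-ratio inequalities
`x/y ≤ x₁/y₁ ≤ x₂/y₂ ≤ 1 ≤ (1-x₂)/(1-y₂) ≤ (1-x₁)/(1-y₁) ≤ (1-x)/(1-y)` holds. -/
theorem bscT_likelihood_ratio_chain (x y ρ₁ ρ₂ : ℝ)
    (hx : 0 < x) (hxy : x ≤ y) (hy : y < 1)
    (h1 : 0 ≤ ρ₁) (h12 : ρ₁ ≤ ρ₂) (h2 : ρ₂ ≤ 1/2) :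
    x / y ≤ (bscT ρ₁ (x, y)).1 / (bscT ρ₁ (x, y)).2 ∧
    (bscT ρ₁ (x, y)).1 / (bscT ρ₁ (x, y)).2 ≤ (bscT ρ₂ (x, y)).1 / (bscT ρ₂ (x, y)).2 ∧
    (bscT ρ₂ (x, y)).1 / (bscT ρ₂ (x, y)).2 ≤ 1 ∧
    (1 : ℝ) ≤ (1 - (bscT ρ₂ (x, y)).1) / (1 - (bscT ρ₂ (x, y)).2) ∧
    (1 - (bscT ρ₂ (x, y)).1) / (1 - (bscT ρ₂ (x, y)).2) ≤
      (1 - (bscT ρ₁ (x, y)).1) / (1 - (bscT ρ₁ (x, y)).2) ∧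
    (1 - (bscT ρ₁ (x, y)).1) / (1 - (bscT ρ₁ (x, y)).2) ≤ (1 - x) / (1 - y) := by
  have hy' : y ∈ Set.Ioo (0 : ℝ) 1 := ⟨hx.trans_le hxy, hy⟩
  have hρ₂ : ρ₂ ≤ 1 := by linarith
  have hρ₁ : ρ₁ ≤ 1 := h12.trans hρ₂
  have hy₂ := bsc_mem_Ioo ⟨h1.trans h12, hρ₂⟩ hy'
  have hxy₂ : (bscT ρ₂ (x, y)).1 ≤ (bscT ρ₂ (x, y)).2 :=
    add_le_add_right (mul_le_mul_of_nonneg_left hxy (by linarith)) ρ₂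
  refine ⟨?_, bscT_fst_div_snd_le hxy hy' h1 h12 hρ₂, div_le_one_of_le₀ hxy₂ hy₂.1.le,
    (one_le_div (sub_pos.2 hy₂.2)).2 (sub_le_sub_left hxy₂ 1),
    bscT_one_sub_fst_div_one_sub_snd_le hxy hy' h1 h12 hρ₂, ?_⟩
  · simpa only [bscT_zero] using bscT_fst_div_snd_le hxy hy' le_rfl h1 hρ₁
  · simpa only [bscT_zero] using bscT_one_sub_fst_div_one_sub_snd_le hxy hy' le_rfl h1 hρ₁
end

section
/- Let 0 ≤ ρ_e < 1/2, let I be an open interval, let y : ℝ → ℝ be differentiable at x₀ ∈ I, and define x_e(t) = ρ_e + (1−2ρ_e)t and y_e(t) = ρ_e + (1−2ρ_e)y(t). Assume 0 < x_e(x₀) < y_e(x₀) < 1 and that there is a constant α̃ with D(x_e(t), y_e(t)) = α̃ for all t ∈ I (the operating point stays on the eavesdropper's constraint boundary). Then the slope of the constraint curve satisfies y′(x₀) = [log((1−x_e)/(1−y_e)) − log(x_e/y_e)] / [(1−x_e)/(1−y_e) − x_e/y_e], where x_e = x_e(x₀) and y_e = y_e(x₀). -/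
/-- The binary Kullback–Leibler divergence of an operating point `(x, y)`. -/
noncomputable def klBin (x y : ℝ) : ℝ :=
  x * Real.log (x / y) + (1 - x) * Real.log ((1 - x) / (1 - y))

theorem HasDerivAt.klBin {u v : ℝ → ℝ} {u' v' t : ℝ} (hu : HasDerivAt u u' t)
    (hv : HasDerivAt v v' t) (hu0 : u t ≠ 0) (hu1 : 1 - u t ≠ 0) (hv0 : v t ≠ 0)
    (hv1 : 1 - v t ≠ 0) :
    HasDerivAt (fun s => klBin (u s) (v s))
      ((Real.log (u t / v t) - Real.log ((1 - u t) / (1 - v t))) * u' +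
        ((1 - u t) / (1 - v t) - u t / v t) * v') t := by
  have hu' := hu.const_sub 1
  have h := (hu.mul ((hu.div hv hv0).log (div_ne_zero hu0 hv0))).add
    (hu'.mul ((hu'.div (hv.const_sub 1) hv1).log (div_ne_zero hu1 hv1)))
  refine h.congr_deriv ?_
  simp only [Pi.div_apply]
  field_simp
  ring

/-- If the operating point `(t, y(t))` stays on the eavesdropper's constraint
boundary `D(x_e, y_e) = α̃`, where `x_e(t) = ρ_e + (1-2ρ_e)t` and
`y_e(t) = ρ_e + (1-2ρ_e)y(t)`, and `y` is differentiable at `x₀`, then the slope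
of the constraint curve is
`y′(x₀) = [log((1-x_e)/(1-y_e)) − log(x_e/y_e)] / [(1-x_e)/(1-y_e) − x_e/y_e]`. -/
theorem eve_constraint_slope (ρe a b x₀ αt : ℝ) (y : ℝ → ℝ)
    (hρ0 : 0 ≤ ρe) (hρ : ρe < 1/2)
    (hx₀ : x₀ ∈ Set.Ioo a b)
    (hdiff : DifferentiableAt ℝ y x₀)
    (hxe : 0 < ρe + (1 - 2 * ρe) * x₀)
    (hxye : ρe + (1 - 2 * ρe) * x₀ < ρe + (1 - 2 * ρe) * y x₀)
    (hye : ρe + (1 - 2 * ρe) * y x₀ < 1)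
    (hconst : ∀ t ∈ Set.Ioo a b,
      klBin (ρe + (1 - 2 * ρe) * t) (ρe + (1 - 2 * ρe) * y t) = αt) :
    deriv y x₀ =
      (Real.log ((1 - (ρe + (1 - 2 * ρe) * x₀)) / (1 - (ρe + (1 - 2 * ρe) * y x₀)))
          - Real.log ((ρe + (1 - 2 * ρe) * x₀) / (ρe + (1 - 2 * ρe) * y x₀))) /
        ((1 - (ρe + (1 - 2 * ρe) * x₀)) / (1 - (ρe + (1 - 2 * ρe) * y x₀))
          - (ρe + (1 - 2 * ρe) * x₀) / (ρe + (1 - 2 * ρe) * y x₀)) := by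
  have hc : 1 - 2 * ρe ≠ 0 := by linarith
  have hx1 := hxye.trans hye
  have hy0 := hxe.trans hxye
  have hu : HasDerivAt (fun t => ρe + (1 - 2 * ρe) * t) (1 - 2 * ρe) x₀ := by
    simpa using ((hasDerivAt_id x₀).const_mul (1 - 2 * ρe)).const_add ρe
  have hv := (hdiff.hasDerivAt.const_mul (1 - 2 * ρe)).const_add ρe
  have hkl := hu.klBin hv hxe.ne' (sub_pos.2 hx1).ne' hy0.ne' (sub_pos.2 hye).ne'
  have hloc : (fun t => klBin (ρe + (1 - 2 * ρe) * t) (ρe + (1 - 2 * ρe) * y t))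
      =ᶠ[nhds x₀] fun _ => αt :=
    Filter.eventually_of_mem (Ioo_mem_nhds hx₀.1 hx₀.2) hconst
  have hzero := hkl.unique ((hasDerivAt_const x₀ αt).congr_of_eventuallyEq hloc)
  have hlt : (ρe + (1 - 2 * ρe) * x₀) / (ρe + (1 - 2 * ρe) * y x₀) <
      (1 - (ρe + (1 - 2 * ρe) * x₀)) / (1 - (ρe + (1 - 2 * ρe) * y x₀)) :=
    ((div_lt_one hy0).2 hxye).trans ((one_lt_div (sub_pos.2 hye)).2 (by linarith))
  rw [eq_div_iff (sub_pos.2 hlt).ne']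
  apply mul_left_cancel₀ hc
  linear_combination hzero
end

section
/- Let x, y ∈ (0,1), ρ ∈ [0,1], and write x̂ = ρ + (1−2ρ)x, ŷ = ρ + (1−2ρ)y, assuming x̂, ŷ ∈ (0,1). Then the following algebraic identity holds: ((1−x)/(1−y)² + x/y²) − (ŷ(1−ŷ)/(y(1−y)))·((1−x̂)/(1−ŷ)² + x̂/ŷ²) = ρ(1−ρ)(y−x)(2y−1) / (y²(1−y)²·ŷ(1−ŷ)). -/
/-- The algebraic identity for the quantity `T₁` arising in the second derivative
of the sensor's KL divergence along the eavesdropper's constraint curve: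
`((1-x)/(1-y)² + x/y²) − (ŷ(1-ŷ)/(y(1-y)))·((1-x̂)/(1-ŷ)² + x̂/ŷ²)
  = ρ(1-ρ)(y-x)(2y-1) / (y²(1-y)²·ŷ(1-ŷ))`,
where `x̂ = ρ + (1-2ρ)x` and `ŷ = ρ + (1-2ρ)y`. -/
theorem T1_identity (x y ρ : ℝ)
    (hx : x ∈ Set.Ioo (0 : ℝ) 1) (hy : y ∈ Set.Ioo (0 : ℝ) 1)
    (hρ : ρ ∈ Set.Icc (0 : ℝ) 1)
    (hxh : ρ + (1 - 2 * ρ) * x ∈ Set.Ioo (0 : ℝ) 1)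
    (hyh : ρ + (1 - 2 * ρ) * y ∈ Set.Ioo (0 : ℝ) 1) :
    ((1 - x) / (1 - y) ^ 2 + x / y ^ 2)
      - ((ρ + (1 - 2 * ρ) * y) * (1 - (ρ + (1 - 2 * ρ) * y)) / (y * (1 - y)))
        * ((1 - (ρ + (1 - 2 * ρ) * x)) / (1 - (ρ + (1 - 2 * ρ) * y)) ^ 2
            + (ρ + (1 - 2 * ρ) * x) / (ρ + (1 - 2 * ρ) * y) ^ 2) =
    ρ * (1 - ρ) * (y - x) * (2 * y - 1) /
      (y ^ 2 * (1 - y) ^ 2 * (ρ + (1 - 2 * ρ) * y) * (1 - (ρ + (1 - 2 * ρ) * y))) := by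
  have hy₀ : y ≠ 0 := hy.1.ne'
  have hy₁ : 1 - y ≠ 0 := (sub_pos.2 hy.2).ne'
  obtain ⟨v, hv⟩ : ∃ v, v = ρ + (1 - 2 * ρ) * y := ⟨_, rfl⟩
  rw [← hv] at hyh ⊢
  have hv₀ : v ≠ 0 := hyh.1.ne'
  have hv₁ : 1 - v ≠ 0 := (sub_pos.2 hyh.2).ne'
  field_simp
  rw [hv]
  ring
end

section
/- Let x, y ∈ (0,1), ρ ∈ [0,1], and write x̂ = ρ + (1−2ρ)x, ŷ = ρ + (1−2ρ)y, assuming x̂, ŷ ∈ (0,1). Then the following algebraic identity holds: (1/x + 1/(1−x)) − (ŷ(1−ŷ)/(y(1−y)))·(1/x̂ + 1/(1−x̂)) = ρ(1−ρ)(y−x)(1−x−y) / (y(1−y)·x(1−x)·x̂(1−x̂)). -/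
/-- The algebraic identity for the quantity `T₃` arising in the second derivative
of the sensor's KL divergence along the eavesdropper's constraint curve:
`(1/x + 1/(1-x)) − (ŷ(1-ŷ)/(y(1-y)))·(1/x̂ + 1/(1-x̂))
  = ρ(1-ρ)(y-x)(1-x-y) / (y(1-y)·x(1-x)·x̂(1-x̂))`,
where `x̂ = ρ + (1-2ρ)x` and `ŷ = ρ + (1-2ρ)y`. -/
theorem T3_identity (x y ρ : ℝ)
    (hx : x ∈ Set.Ioo (0 : ℝ) 1) (hy : y ∈ Set.Ioo (0 : ℝ) 1)
    (hρ : ρ ∈ Set.Icc (0 : ℝ) 1)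
    (hxh : ρ + (1 - 2 * ρ) * x ∈ Set.Ioo (0 : ℝ) 1)
    (hyh : ρ + (1 - 2 * ρ) * y ∈ Set.Ioo (0 : ℝ) 1) :
    (1 / x + 1 / (1 - x))
      - ((ρ + (1 - 2 * ρ) * y) * (1 - (ρ + (1 - 2 * ρ) * y)) / (y * (1 - y)))
        * (1 / (ρ + (1 - 2 * ρ) * x) + 1 / (1 - (ρ + (1 - 2 * ρ) * x))) =
    ρ * (1 - ρ) * (y - x) * (1 - x - y) /
      (y * (1 - y) * (x * (1 - x)) *
        ((ρ + (1 - 2 * ρ) * x) * (1 - (ρ + (1 - 2 * ρ) * x)))) := by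
  have hx0 : x ≠ 0 := hx.1.ne'
  have hx1 : 1 - x ≠ 0 := (sub_pos.2 hx.2).ne'
  have hy0 : y ≠ 0 := hy.1.ne'
  have hy1 : 1 - y ≠ 0 := (sub_pos.2 hy.2).ne'
  have hxh0 := hxh.1.ne'
  have hxh1 := (sub_pos.2 hxh.2).ne'
  rw [div_add_div _ _ hx0 hx1, div_add_div _ _ hxh0 hxh1, div_mul_div_comm,
    div_sub_div _ _ (mul_ne_zero hx0 hx1)
      (mul_ne_zero (mul_ne_zero hy0 hy1) (mul_ne_zero hxh0 hxh1)),
    div_eq_div_iff (by positivity) (by positivity)]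
  ring
end

section
/- Let 0 ≤ ρ_e < 1/2, let I be an open interval, let y : ℝ → ℝ be twice differentiable on I with 0 < t < y(t) < 1 for all t ∈ I, and define x_e(t) = ρ_e + (1−2ρ_e)t and y_e(t) = ρ_e + (1−2ρ_e)y(t). Assume there is a constant α̃ with D(x_e(t), y_e(t)) = α̃ for all t ∈ I. Then for every x₀ ∈ I, writing y = y(x₀), s = y′(x₀), x̂ = x_e(x₀), ŷ = y_e(x₀), the function g(t) = D(t, y(t)) satisfies g″(x₀) = ρ_e(1−ρ_e)·(y−x₀)/(y(1−y)) · [ ((2y−1)/(y·ŷ·(1−y)·(1−ŷ)))·s² + (1−x₀−y)/(x₀·x̂·(1−x₀)·(1−x̂)) ]. -/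
/-- Derivative of the binary divergence along a differentiable path of operating points. -/
theorem hasDerivAt_klBin {u v : ℝ → ℝ} {u' v' t : ℝ} (hu : HasDerivAt u u' t)
    (hv : HasDerivAt v v' t) (hu0 : 0 < u t) (hu1 : u t < 1) (hv0 : 0 < v t) (hv1 : v t < 1) :
    HasDerivAt (fun t => klBin (u t) (v t))
      (u' * (Real.log (u t / v t) - Real.log ((1 - u t) / (1 - v t)))
        + (v t - u t) / (v t * (1 - v t)) * v') t := by
  have hu2 : 0 < 1 - u t := by linarith
  have hv2 : 0 < 1 - v t := by linarith
  have h₁ := (hu.div hv hv0.ne').log (div_pos hu0 hv0).ne'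
  have h₂ := ((hu.const_sub 1).div (hv.const_sub 1) hv2.ne').log (div_pos hu2 hv2).ne'
  refine ((hu.mul h₁).add ((hu.const_sub 1).mul h₂)).congr_deriv ?_
  simp only [Pi.div_apply]
  field_simp
  ring

/-- Second derivative of the binary divergence along a path whose first coordinate has
constant speed `k`. -/
theorem deriv_deriv_klBin {u v v' : ℝ → ℝ} {k v'' x₀ : ℝ} {s : Set ℝ} (hs : IsOpen s)
    (hx₀ : x₀ ∈ s) (hu : ∀ t ∈ s, HasDerivAt u k t) (hv : ∀ t ∈ s, HasDerivAt v (v' t) t)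
    (hv' : HasDerivAt v' v'' x₀) (hu01 : ∀ t ∈ s, 0 < u t ∧ u t < 1)
    (hv01 : ∀ t ∈ s, 0 < v t ∧ v t < 1) :
    deriv (deriv (fun t => klBin (u t) (v t))) x₀ =
      k ^ 2 / (u x₀ * (1 - u x₀)) - 2 * k * v' x₀ / (v x₀ * (1 - v x₀))
        + v' x₀ ^ 2 * ((u x₀ - 2 * u x₀ * v x₀ + v x₀ ^ 2) / (v x₀ * (1 - v x₀)) ^ 2)
        + (v x₀ - u x₀) / (v x₀ * (1 - v x₀)) * v'' := by
  have hderiv : deriv (fun t => klBin (u t) (v t)) =ᶠ[nhds x₀] fun t =>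
      k * (Real.log (u t / v t) - Real.log ((1 - u t) / (1 - v t)))
        + (v t - u t) / (v t * (1 - v t)) * v' t := by
    filter_upwards [hs.mem_nhds hx₀] with t ht
    exact (hasDerivAt_klBin (hu t ht) (hv t ht) (hu01 t ht).1 (hu01 t ht).2 (hv01 t ht).1
      (hv01 t ht).2).deriv
  rw [hderiv.deriv_eq]
  obtain ⟨hu0, hu1⟩ := hu01 x₀ hx₀
  obtain ⟨hv0, hv1⟩ := hv01 x₀ hx₀
  have hu2 : 0 < 1 - u x₀ := by linarith
  have hv2 : 0 < 1 - v x₀ := by linarith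
  have hU := hu x₀ hx₀
  have hV := hv x₀ hx₀
  have h₁ := (hU.div hV hv0.ne').log (div_pos hu0 hv0).ne'
  have h₂ := ((hU.const_sub 1).div (hV.const_sub 1) hv2.ne').log (div_pos hu2 hv2).ne'
  have h₃ := (hV.sub hU).div (hV.mul (hV.const_sub 1)) (mul_pos hv0 hv2).ne'
  refine ((((h₁.sub h₂).const_mul k).add (h₃.mul hv')).congr_deriv ?_).deriv
  simp only [Pi.div_apply, Pi.sub_apply, Pi.mul_apply]
  field_simp
  ring

/-- Along the eavesdropper's constraint boundary
`D(ρ_e + (1-2ρ_e)t, ρ_e + (1-2ρ_e)y(t)) = α̃`, the second derivative of the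
sensor's KL divergence `g(t) = D(t, y(t))` is
`g″(x₀) = ρ_e(1-ρ_e)·(y-x₀)/(y(1-y)) ·
  [ ((2y-1)/(y·ŷ·(1-y)·(1-ŷ)))·s² + (1-x₀-y)/(x₀·x̂·(1-x₀)·(1-x̂)) ]`,
where `y = y(x₀)`, `s = y′(x₀)`, `x̂ = ρ_e + (1-2ρ_e)x₀` and `ŷ = ρ_e + (1-2ρ_e)y`. -/
theorem klBin_second_deriv_along_eve_constraint (ρe a b αt : ℝ) (y : ℝ → ℝ)
    (hρ0 : 0 ≤ ρe) (hρ : ρe < 1/2)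
    (hdiff : ∀ t ∈ Set.Ioo a b, DifferentiableAt ℝ y t)
    (hdiff2 : ∀ t ∈ Set.Ioo a b, DifferentiableAt ℝ (deriv y) t)
    (hdom : ∀ t ∈ Set.Ioo a b, 0 < t ∧ t < y t ∧ y t < 1)
    (hconst : ∀ t ∈ Set.Ioo a b,
      klBin (ρe + (1 - 2 * ρe) * t) (ρe + (1 - 2 * ρe) * y t) = αt) :
    ∀ x₀ ∈ Set.Ioo a b,
      deriv (deriv (fun t => klBin t (y t))) x₀ =
        ρe * (1 - ρe) * (y x₀ - x₀) / (y x₀ * (1 - y x₀)) *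
          ( ((2 * y x₀ - 1) /
              (y x₀ * (ρe + (1 - 2 * ρe) * y x₀) * (1 - y x₀)
                * (1 - (ρe + (1 - 2 * ρe) * y x₀)))) * (deriv y x₀) ^ 2
            + (1 - x₀ - y x₀) /
              (x₀ * (ρe + (1 - 2 * ρe) * x₀) * (1 - x₀)
                * (1 - (ρe + (1 - 2 * ρe) * x₀))) ) := by
  intro x₀ hx₀
  have hk : 0 < 1 - 2 * ρe := by linarith
  have hy (t) (ht : t ∈ Set.Ioo a b) : HasDerivAt y (deriv y t) t := (hdiff t ht).hasDerivAt
  have hy' := (hdiff2 x₀ hx₀).hasDerivAt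
  have hEve01 (z : ℝ) (hz0 : 0 < z) (hz1 : z < 1) :
      0 < ρe + (1 - 2 * ρe) * z ∧ ρe + (1 - 2 * ρe) * z < 1 := by
    constructor <;> nlinarith [mul_pos hk hz0, mul_pos hk (sub_pos.2 hz1)]
  have hx01 (t) (ht : t ∈ Set.Ioo a b) : 0 < t ∧ t < 1 := by
    obtain ⟨h₀, h₁, h₂⟩ := hdom t ht
    exact ⟨h₀, h₁.trans h₂⟩
  have hy01 (t) (ht : t ∈ Set.Ioo a b) : 0 < y t ∧ y t < 1 := by
    obtain ⟨h₀, h₁, h₂⟩ := hdom t ht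
    exact ⟨h₀.trans h₁, h₂⟩
  have hsensor := deriv_deriv_klBin isOpen_Ioo hx₀ (fun t _ => hasDerivAt_id' t) hy hy' hx01 hy01
  have heve := deriv_deriv_klBin isOpen_Ioo hx₀
    (fun t _ => ((hasDerivAt_id' t).const_mul (1 - 2 * ρe)).const_add ρe)
    (fun t ht => ((hy t ht).const_mul (1 - 2 * ρe)).const_add ρe) (hy'.const_mul (1 - 2 * ρe))
    (fun t ht => hEve01 t (hx01 t ht).1 (hx01 t ht).2)
    (fun t ht => hEve01 (y t) (hy01 t ht).1 (hy01 t ht).2)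
  have hzero : deriv (deriv fun t =>
      klBin (ρe + (1 - 2 * ρe) * t) (ρe + (1 - 2 * ρe) * y t)) x₀ = 0 := by
    have h : (fun t => klBin (ρe + (1 - 2 * ρe) * t) (ρe + (1 - 2 * ρe) * y t))
        =ᶠ[nhds x₀] fun _ => αt := by
      filter_upwards [isOpen_Ioo.mem_nhds hx₀] with t ht using hconst t ht
    simp [h.deriv.deriv_eq]
  rw [hzero] at heve
  rw [hsensor]
  obtain ⟨hx0, hx1⟩ := hx01 x₀ hx₀
  obtain ⟨hy0, hy1⟩ := hy01 x₀ hx₀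
  obtain ⟨hxe0, hxe1⟩ := hEve01 x₀ hx0 hx1
  obtain ⟨hye0, hye1⟩ := hEve01 (y x₀) hy0 hy1
  generalize deriv (deriv y) x₀ = r at *
  generalize deriv y x₀ = s at *
  generalize y x₀ = z at *
  have hx2 := (sub_pos.2 hx1).ne'
  have hy2 := (sub_pos.2 hy1).ne'
  have hxe2 := (sub_pos.2 hxe1).ne'
  have hye2 := (sub_pos.2 hye1).ne'
  generalize hX : ρe + (1 - 2 * ρe) * x₀ = X at *
  generalize hZ : ρe + (1 - 2 * ρe) * z = Z at *
  have hr : (z - x₀) * r = -(Z * (1 - Z) / (X * (1 - X)) - 2 * s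
      + s ^ 2 * ((X - 2 * X * Z + Z ^ 2) / (Z * (1 - Z)))) := by
    have hZX : Z - X = (1 - 2 * ρe) * (z - x₀) := by rw [← hX, ← hZ]; ring
    rw [hZX] at heve
    field_simp at heve ⊢
    have h := (mul_eq_zero.1 (heve.symm.trans (by ring))).resolve_left (pow_ne_zero 2 hk.ne')
    linarith
  rw [div_mul_eq_mul_div (z - x₀), hr]
  field_simp
  rw [← hX, ← hZ]
  ring
end

section
/- Let 0 ≤ ρ_fc < 1/2 and let S be a nonempty subset of {(x,y) ∈ ℝ² : 0 < x < y < 1}. If (x*, y*) ∈ S maximizes the fusion center's KL divergence (x,y) ↦ D(ρ_fc + (1−2ρ_fc)x, ρ_fc + (1−2ρ_fc)y) over S, then for every y′ with y* < y′ < 1 the point (x*, y′) does not belong to S; that is, the optimal operating point lies on the upper boundary of the feasible set of operating points (so when the feasible set is the region under the likelihood-ratio-test curve, the optimal quantizer is a likelihood ratio quantizer). -/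
theorem klBin_lt_klBin {x y z : ℝ} (hx : 0 < x) (hxy : x < y) (hyz : y < z) (hz : z < 1) :
    klBin x y < klBin x z := by
  have hy : 0 < y := hx.trans hxy
  have hy' : 0 < 1 - y := by linarith
  have hz' : 0 < 1 - z := by linarith
  have hx' : 0 < 1 - x := by linarith
  have hlog : Real.log (z / y) ≤ z / y - 1 :=
    Real.log_le_sub_one_of_pos (div_pos (hy.trans hyz) hy)
  have hlog' : Real.log ((1 - z) / (1 - y)) ≤ (1 - z) / (1 - y) - 1 :=
    Real.log_le_sub_one_of_pos (div_pos hz' hy')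
  rw [Real.log_div (by linarith) hy.ne'] at hlog
  rw [Real.log_div hz'.ne' hy'.ne'] at hlog'
  have hbound := mul_le_mul_of_nonneg_left hlog hx.le
  have hbound' := mul_le_mul_of_nonneg_left hlog' hx'.le
  have hslope : x * (z / y - 1) + (1 - x) * ((1 - z) / (1 - y) - 1) < 0 := by
    have heq : x * (z / y - 1) + (1 - x) * ((1 - z) / (1 - y) - 1) =
        -((z - y) * (y - x) / (y * (1 - y))) := by
      field_simp
      ring
    rw [heq, neg_lt_zero]
    exact div_pos (mul_pos (sub_pos.2 hyz) (sub_pos.2 hxy)) (mul_pos hy hy')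
  unfold klBin
  rw [Real.log_div hx.ne' hy.ne', Real.log_div hx'.ne' hy'.ne',
    Real.log_div hx.ne' (hy.trans hyz).ne', Real.log_div hx'.ne' hz'.ne']
  linarith

/-- If `(x*, y*)` maximizes the fusion center's KL divergence
`(x,y) ↦ D(ρ_fc + (1-2ρ_fc)x, ρ_fc + (1-2ρ_fc)y)` over a nonempty feasible set
`S ⊆ {(x,y) : 0 < x < y < 1}`, then no point `(x*, y′)` with `y* < y′ < 1`
belongs to `S`: the optimal operating point lies on the upper boundary of the
feasible set. -/
theorem optimal_on_upper_boundary (ρfc : ℝ) (S : Set (ℝ × ℝ))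
    (hρ0 : 0 ≤ ρfc) (hρ : ρfc < 1/2)
    (hS : S ⊆ {p : ℝ × ℝ | 0 < p.1 ∧ p.1 < p.2 ∧ p.2 < 1})
    (hne : S.Nonempty)
    (xs ys : ℝ) (hmem : (xs, ys) ∈ S)
    (hmax : ∀ p ∈ S,
      klBin (ρfc + (1 - 2 * ρfc) * p.1) (ρfc + (1 - 2 * ρfc) * p.2) ≤
        klBin (ρfc + (1 - 2 * ρfc) * xs) (ρfc + (1 - 2 * ρfc) * ys)) :
    ∀ y' : ℝ, ys < y' → y' < 1 → (xs, y') ∉ S := by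
  intro y' hy hy' hmem'
  obtain ⟨hx, hxy, -⟩ := hS hmem
  have hc : 0 < 1 - 2 * ρfc := by linarith
  dsimp only at hx hxy
  refine (hmax _ hmem').not_gt (klBin_lt_klBin ?_ ?_ ?_ ?_)
  · positivity
  · gcongr
  · dsimp only
    gcongr
  · dsimp only
    nlinarith [mul_pos hc (sub_pos.2 hy')]
end
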